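/- arXiv:2404.00662 — 4 statements merged into one kernel-verified Lean document; each statement's English description precedes it below -/
import Mathlib

section
/- For r ≥ 1 let T(r) denote the unique positive solution T of sinh(2/T)·sinh(2/(rT)) = 1. Then T(r)·log r → 2 as r → ∞. -/
open Real Filter

/-- A linear upper bound for `sinh` on the unit interval. -/
lemma sinh_le_two_mul {u : ℝ} (h0 : 0 ≤ u) (h1 : u ≤ 1) : Real.sinh u ≤ 2 * u := by
  have h := (abs_le.mp (Real.abs_exp_sub_one_sub_id_le (x := u) (by rwa [abs_of_nonneg h0]))).2
  have h' := Real.add_one_le_exp (-u)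
  rw [Real.sinh_eq]
  nlinarith

lemma le_log_add_of_sinh_mul_sinh_eq_one {r x : ℝ} (hr : 1 ≤ r) (hx : 0 < x)
    (h : Real.sinh x * Real.sinh (x / r) = 1) : x ≤ Real.log r + Real.log 3 := by
  have hr0 : 0 < r := by linarith
  rw [← Real.log_mul hr0.ne' (by norm_num), Real.le_log_iff_exp_le (by positivity)]
  rcases le_total x 1 with hx1 | hx1
  · have := Real.exp_le_exp.mpr hx1
    have := Real.exp_one_lt_d9
    linarith
  · have hs : 0 < Real.sinh x := Real.sinh_pos_iff.mpr hx
    have hle : x / r ≤ Real.sinh (x / r) := Real.self_le_sinh_iff.mpr (by positivity)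
    have h1 : Real.sinh x * (x / r) ≤ 1 := h ▸ mul_le_mul_of_nonneg_left hle hs.le
    have h2 : Real.sinh x * x ≤ r := by
      rwa [← mul_div_assoc, div_le_one hr0] at h1
    have h3 : Real.sinh x ≤ r := by nlinarith
    have h4 : Real.exp (-x) ≤ 1 := Real.exp_le_one_iff.mpr (by linarith)
    rw [Real.sinh_eq] at h3
    linarith

lemma log_sub_log_le_of_sinh_mul_sinh_eq_one {r x : ℝ} (hr : 5 ≤ r) (hx : 0 < x)
    (h : Real.sinh x * Real.sinh (x / r) = 1) :
    Real.log r - Real.log (Real.log r + Real.log 3) ≤ x := by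
  have hr0 : 0 < r := by linarith
  have hub := le_log_add_of_sinh_mul_sinh_eq_one (by linarith) hx h
  have hxr : x ≤ r := by
    have h1 : Real.log r = Real.log (r / 3) + Real.log 3 := by
      rw [← Real.log_mul (by positivity) (by norm_num), div_mul_cancel₀ _ (by norm_num)]
    have h2 := Real.log_le_sub_one_of_pos (show 0 < r / 3 by positivity)
    have h3 := Real.log_le_sub_one_of_pos (show (0 : ℝ) < 3 by norm_num)
    linarith
  have hs := sinh_le_two_mul (u := x / r) (by positivity) ((div_le_one hr0).mpr hxr)
  have hsx : Real.sinh x ≤ Real.exp x / 2 := by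
    rw [Real.sinh_eq]
    linarith [Real.exp_pos (-x)]
  have h1 : 1 ≤ Real.exp x / 2 * (2 * (x / r)) :=
    h ▸ mul_le_mul hsx hs (Real.sinh_nonneg_iff.mpr (by positivity)) (by positivity)
  have h2 : r ≤ Real.exp x * x := by
    rw [show Real.exp x / 2 * (2 * (x / r)) = Real.exp x * x / r by ring, one_le_div hr0] at h1
    exact h1
  have h3 := Real.log_le_log hr0 h2
  rw [Real.log_mul (Real.exp_pos x).ne' hx.ne', Real.log_exp] at h3
  linarith [Real.log_le_log hx hub]

/-- For `r ≥ 1` let `T r` denote the unique positive solution `T` of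
`sinh (2/T) * sinh (2/(r*T)) = 1`.  Then `T r * log r → 2` as `r → ∞`. -/
theorem onsager_critical_temperature_asymptotics
    (T : ℝ → ℝ)
    (hT : ∀ r : ℝ, 1 ≤ r →
      0 < T r ∧ Real.sinh (2 / T r) * Real.sinh (2 / (r * T r)) = 1) :
    Tendsto (fun r : ℝ => T r * Real.log r) atTop (nhds 2) := by
  have heq : ∀ r : ℝ, 1 ≤ r → Real.sinh (2 / T r) * Real.sinh (2 / T r / r) = 1 := fun r hr => by
    rw [div_div, mul_comm (T r) r]
    exact (hT r hr).2
  have hinv : Tendsto (fun L : ℝ => Real.log 3 / L) atTop (nhds 0) :=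
    tendsto_const_nhds.div_atTop tendsto_id
  have hupper : Tendsto (fun L : ℝ => (L + Real.log 3) / L) atTop (nhds 1) := by
    have h := (tendsto_const_nhds (x := (1 : ℝ))).add hinv
    rw [add_zero] at h
    refine h.congr' ?_
    filter_upwards [eventually_gt_atTop 0] with L hL
    field_simp
  have hloglog : Tendsto (fun L : ℝ => Real.log (L + Real.log 3) / (L + Real.log 3))
      atTop (nhds 0) :=
    Real.isLittleO_log_id_atTop.tendsto_div_nhds_zero.comp
      (tendsto_atTop_add_const_right _ _ tendsto_id)
  have hlower : Tendsto (fun L : ℝ => (L - Real.log (L + Real.log 3)) / L) atTop (nhds 1) := by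
    have h := (tendsto_const_nhds (x := (1 : ℝ))).sub (hloglog.mul hupper)
    rw [zero_mul, sub_zero] at h
    refine h.congr' ?_
    filter_upwards [eventually_gt_atTop 0] with L hL
    have : 0 < L + Real.log 3 := add_pos hL (Real.log_pos (by norm_num))
    field_simp
  have hratio : Tendsto (fun r : ℝ => 2 / T r / Real.log r) atTop (nhds 1) := by
    refine tendsto_of_tendsto_of_tendsto_of_le_of_le' (hlower.comp Real.tendsto_log_atTop)
      (hupper.comp Real.tendsto_log_atTop) ?_ ?_
    · filter_upwards [eventually_ge_atTop 5] with r hr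
      have hr1 : 1 ≤ r := by linarith
      exact div_le_div_of_nonneg_right (log_sub_log_le_of_sinh_mul_sinh_eq_one hr
        (div_pos two_pos (hT r hr1).1) (heq r hr1)) (Real.log_nonneg hr1)
    · filter_upwards [eventually_ge_atTop 1] with r hr
      exact div_le_div_of_nonneg_right (le_log_add_of_sinh_mul_sinh_eq_one hr
        (div_pos two_pos (hT r hr).1) (heq r hr)) (Real.log_nonneg hr)
  have h := (tendsto_const_nhds (x := (2 : ℝ))).div hratio one_ne_zero
  rw [div_one] at h
  refine h.congr' ?_
  filter_upwards [eventually_gt_atTop 1] with r hr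
  have := (hT r hr.le).1
  have := Real.log_pos hr
  simp only [Pi.div_apply]
  field_simp
end

section
/- Let F = {(x,y) ∈ ℝ² : y > 0, x² + y² ≥ 1, |x| ≤ 1/2}. For (x,y) ∈ F set r = √(x² + y²) and let T(x,y) be the unique positive real number satisfying sinh(2√y/T)·sinh(2√y/(r·T)) = 1. Then for every real p with 0 < p ≤ 2, the function (x,y) ↦ T(x,y)^p / y² is integrable on F with respect to Lebesgue measure on ℝ². In particular the critical temperature of the Ising model attached to a random unimodular lattice in ℝ² has finite mean and finite variance. -/
open Real MeasureTheory

theorem sinh_le_mul_exp (u : ℝ) : Real.sinh u ≤ u * Real.exp u := by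
  have h := Real.add_one_le_exp (-(2 * u))
  have hm : Real.exp u * Real.exp (-(2 * u)) = Real.exp (-u) := by
    rw [← Real.exp_add]; ring_nf
  rw [Real.sinh_eq]
  nlinarith [mul_le_mul_of_nonneg_left h (Real.exp_pos u).le]

theorem log_le_of_sinh_mul_sinh_eq_one {a r : ℝ} (ha : 0 < a) (hr : 1 ≤ r)
    (h : Real.sinh a * Real.sinh (a / r) = 1) : Real.log (2 * r) ≤ 3 * a := by
  have hr0 : 0 < r := by linarith
  have har : a / r ≤ a := div_le_self ha.le hr
  have har0 : 0 < a / r := by positivity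
  have h1 : Real.sinh a ≤ Real.exp a / 2 := by
    rw [Real.sinh_eq]
    linarith [Real.exp_pos (-a)]
  have h2 : Real.sinh (a / r) ≤ Real.exp a / r * Real.exp a := by
    calc Real.sinh (a / r) ≤ a / r * Real.exp (a / r) := sinh_le_mul_exp _
      _ ≤ Real.exp a / r * Real.exp a := by
        gcongr
        linarith [Real.add_one_le_exp a]
  have h3 : 1 ≤ Real.exp a / 2 * (Real.exp a / r * Real.exp a) := by
    rw [← h]
    exact mul_le_mul h1 h2 (Real.sinh_pos_iff.2 har0).le (by positivity)
  rw [Real.log_le_iff_le_exp (by positivity)]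
  have h4 : Real.exp (3 * a) = Real.exp a * Real.exp a * Real.exp a := by
    rw [← Real.exp_add, ← Real.exp_add]; ring_nf
  have h5 : Real.exp a / 2 * (Real.exp a / r * Real.exp a) = Real.exp (3 * a) / (2 * r) := by
    rw [h4]; field_simp
  rwa [h5, one_le_div (by positivity)] at h3

theorem sinh_div_mul_sinh_div_strictAntiOn {c r : ℝ} (hc : 0 < c) (hr : 0 < r) :
    StrictAntiOn (fun t : ℝ => Real.sinh (c / t) * Real.sinh (c / (r * t))) (Set.Ioi 0) := by
  intro s hs t ht hst
  have hs : 0 < s := hs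
  have ht : 0 < t := ht
  have h1 : c / t < c / s := by gcongr
  have h2 : c / (r * t) < c / (r * s) := by gcongr
  exact mul_lt_mul'' (Real.sinh_lt_sinh.2 h1) (Real.sinh_lt_sinh.2 h2)
    (Real.sinh_pos_iff.2 (by positivity)).le (Real.sinh_pos_iff.2 (by positivity)).le

theorem integrableOn_inv_sq_add_inv_mul_log_sq (C : ℝ) (hC : 0 ≤ C) :
    IntegrableOn (fun y : ℝ => 1 / y ^ 2 + C / (y * Real.log (2 * y) ^ 2)) (Set.Ioi (4 / 5)) := by
  have hlog : ∀ y : ℝ, 4 / 5 ≤ y → 0 < Real.log (2 * y) := fun y hy =>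
    Real.log_pos (by linarith)
  have hderiv : ∀ y ∈ Set.Ici (4 / 5 : ℝ),
      HasDerivAt (fun y : ℝ => -(y⁻¹ + C * (Real.log (2 * y))⁻¹))
        (1 / y ^ 2 + C / (y * Real.log (2 * y) ^ 2)) y := by
    intro y hy
    have hy : 4 / 5 ≤ y := hy
    have hy0 : y ≠ 0 := by linarith
    have hl := (hlog y hy).ne'
    have h1 : HasDerivAt (fun y : ℝ => Real.log (2 * y)) (2 * 1 / (2 * y)) y :=
      ((hasDerivAt_id y).const_mul 2).log (by simpa using hy0)
    refine ((hasDerivAt_inv hy0).add ((h1.inv hl).const_mul C)).neg.congr_deriv ?_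
    field_simp
    ring
  have hlim : Filter.Tendsto (fun y : ℝ => -(y⁻¹ + C * (Real.log (2 * y))⁻¹))
      Filter.atTop (nhds (-(0 + C * 0))) := by
    refine (tendsto_inv_atTop_zero.add (Filter.Tendsto.const_mul C ?_)).neg
    exact tendsto_inv_atTop_zero.comp (Real.tendsto_log_atTop.comp
      (Filter.tendsto_id.const_mul_atTop (by norm_num)))
  refine integrableOn_Ioi_deriv_of_nonneg' hderiv (fun y hy => ?_) hlim
  have hy : 4 / 5 < y := hy
  have hy0 : 0 < y := by linarith
  positivity

theorem Real.rpow_le_one_add_sq {t p : ℝ} (ht : 0 ≤ t) (hp0 : 0 ≤ p) (hp2 : p ≤ 2) :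
    t ^ p ≤ 1 + t ^ 2 := by
  rcases le_total t 1 with h | h
  · linarith [Real.rpow_le_one ht h hp0, sq_nonneg t]
  · have := Real.rpow_le_rpow_of_exponent_le h hp2
    rw [Real.rpow_two] at this
    linarith

/-- Let `F` be the standard fundamental domain for `SL₂(ℤ)` acting on the upper
half-plane.  For `(x,y) ∈ F` set `r = √(x² + y²)` and let `T (x,y)` be the
unique positive real with `sinh (2√y/T) * sinh (2√y/(r*T)) = 1` (the critical
temperature of the Ising model attached to the unimodular lattice of shape
`x + iy`).  Then for every real `0 < p ≤ 2` the function
`(x,y) ↦ T (x,y) ^ p / y²` is integrable on `F`. -/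
theorem critical_temperature_integrable_on_fundamental_domain
    (F : Set (ℝ × ℝ))
    (hF : F = {z : ℝ × ℝ | 0 < z.2 ∧ 1 ≤ z.1 ^ 2 + z.2 ^ 2 ∧ |z.1| ≤ 1 / 2})
    (T : ℝ × ℝ → ℝ)
    (hT : ∀ z ∈ F, 0 < T z ∧
      Real.sinh (2 * Real.sqrt z.2 / T z) *
        Real.sinh (2 * Real.sqrt z.2 / (Real.sqrt (z.1 ^ 2 + z.2 ^ 2) * T z)) = 1)
    (p : ℝ) (hp0 : 0 < p) (hp2 : p ≤ 2) :
    IntegrableOn (fun z : ℝ × ℝ => T z ^ p / z.2 ^ 2) F volume := by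
  have hFm : MeasurableSet F := by
    rw [hF]
    have h1 : Measurable fun z : ℝ × ℝ => z.1 ^ 2 + z.2 ^ 2 := by fun_prop
    have h2 : Measurable fun z : ℝ × ℝ => |z.1| := measurable_fst.abs
    exact (measurableSet_lt measurable_const measurable_snd).inter
      ((measurableSet_le measurable_const h1).inter (measurableSet_le h2 measurable_const))
  have hmem : ∀ z ∈ F, 4 / 5 < z.2 ∧ 1 ≤ z.1 ^ 2 + z.2 ^ 2 ∧ |z.1| ≤ 1 / 2 := by
    intro z hz
    rw [hF] at hz
    obtain ⟨h1, h2, h3⟩ := hz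
    refine ⟨?_, h2, h3⟩
    have := abs_le.1 h3
    nlinarith
  have hTm : AEMeasurable T (volume.restrict F) := by
    refine aemeasurable_restrict_of_measurable_subtype hFm (measurable_of_Iio fun t => ?_)
    rcases le_or_gt t 0 with ht | ht
    · convert MeasurableSet.empty
      ext z
      simpa using ht.trans (hT z z.2).1.le
    · have hset : (fun z : F => T z) ⁻¹' Set.Iio t = {z : F |
          Real.sinh (2 * Real.sqrt z.1.2 / t) *
            Real.sinh (2 * Real.sqrt z.1.2 / (Real.sqrt (z.1.1 ^ 2 + z.1.2 ^ 2) * t)) < 1} := by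
        ext z
        obtain ⟨hy, hr, -⟩ := hmem z z.2
        obtain ⟨hz, h1⟩ := hT z z.2
        have hc : 0 < 2 * Real.sqrt z.1.2 := by
          have := Real.sqrt_pos.2 (show 0 < z.1.2 by linarith)
          linarith
        have := (sinh_div_mul_sinh_div_strictAntiOn hc
          (Real.sqrt_pos.2 (show 0 < z.1.1 ^ 2 + z.1.2 ^ 2 by linarith))).lt_iff_gt ht hz
        simp only [h1] at this
        exact this.symm
      rw [hset]
      exact measurableSet_lt (by fun_prop) measurable_const
  have hbound : IntegrableOn
      (fun z : ℝ × ℝ => 1 / z.2 ^ 2 + 36 / (z.2 * Real.log (2 * z.2) ^ 2)) F volume := by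
    have hsub : F ⊆ Set.Icc (-(1 / 2)) (1 / 2) ×ˢ Set.Ioi (4 / 5) := fun z hz =>
      ⟨abs_le.1 (hmem z hz).2.2, (hmem z hz).1⟩
    refine IntegrableOn.mono_set ?_ hsub
    rw [IntegrableOn, Measure.volume_eq_prod, ← Measure.prod_restrict]
    exact Integrable.comp_snd
      (integrableOn_inv_sq_add_inv_mul_log_sq 36 (by norm_num)) _
  refine hbound.mono' ((hTm.pow_const p).div (by fun_prop)).aestronglyMeasurable ?_
  filter_upwards [ae_restrict_mem hFm] with z hz
  obtain ⟨hy, hr, -⟩ := hmem z hz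
  obtain ⟨hTz, h1⟩ := hT z hz
  have hy0 : 0 < z.2 := by linarith
  have hs := Real.sqrt_pos.2 hy0
  set r := Real.sqrt (z.1 ^ 2 + z.2 ^ 2) with hrdef
  have hr1 : 1 ≤ r := Real.one_le_sqrt.2 hr
  have hyr : z.2 ≤ r := Real.le_sqrt_of_sq_le (by nlinarith [sq_nonneg z.1])
  have hlog : 0 < Real.log (2 * z.2) := Real.log_pos (by linarith)
  have ha : Real.log (2 * z.2) ≤ 3 * (2 * Real.sqrt z.2 / T z) := by
    refine (Real.log_le_log (by linarith) (by linarith)).trans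
      (log_le_of_sinh_mul_sinh_eq_one (by positivity) hr1 ?_)
    rw [← h1, div_div, mul_comm (T z)]
  have hTle : T z * Real.log (2 * z.2) ≤ 6 * Real.sqrt z.2 := by
    have : 3 * (2 * Real.sqrt z.2 / T z) = 6 * Real.sqrt z.2 / T z := by ring
    rw [this, le_div_iff₀ hTz] at ha
    linarith
  have hsq : T z ^ 2 * Real.log (2 * z.2) ^ 2 ≤ 36 * z.2 := by
    calc T z ^ 2 * Real.log (2 * z.2) ^ 2 = (T z * Real.log (2 * z.2)) ^ 2 := by ring
      _ ≤ (6 * Real.sqrt z.2) ^ 2 := by gcongr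
      _ = 36 * z.2 := by rw [mul_pow, Real.sq_sqrt hy0.le]; norm_num
  have hTsq : T z ^ 2 / z.2 ^ 2 ≤ 36 / (z.2 * Real.log (2 * z.2) ^ 2) := by
    rw [div_le_div_iff₀ (by positivity) (by positivity)]
    nlinarith [mul_le_mul_of_nonneg_left hsq hy0.le]
  rw [Real.norm_of_nonneg (by positivity)]
  calc T z ^ p / z.2 ^ 2 ≤ (1 + T z ^ 2) / z.2 ^ 2 := by
        gcongr
        exact Real.rpow_le_one_add_sq hTz.le hp0.le hp2
    _ = 1 / z.2 ^ 2 + T z ^ 2 / z.2 ^ 2 := add_div _ _ _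
    _ ≤ _ := by gcongr
end

section
/- Let d ≥ 2 be an integer, t > 0 and p a real number. The function y ↦ exp(∑_{i=1}^{d-1} (i(d−i) − p(d−i)/d)·y_i) on ℝ^{d−1} is integrable over the region {y ∈ ℝ^{d−1} : y_i ≤ log t for all i = 1, …, d−1} (with respect to Lebesgue measure) if and only if p < d. -/
open Real MeasureTheory

/-- An exponential of a linear form is integrable over a negative orthant if and only if all
coefficients of the form are positive. -/
theorem integrableOn_exp_sum_mul_orthant_iff {ι : Type*} [Fintype ι] (c : ι → ℝ) (b : ℝ) :
    IntegrableOn (fun y : ι → ℝ => Real.exp (∑ i, c i * y i)) {y | ∀ i, y i ≤ b} volume ↔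
      ∀ i, 0 < c i := by
  classical
  have hset : {y : ι → ℝ | ∀ i, y i ≤ b} = Set.univ.pi fun _ => Set.Iic b := by
    ext y; simp only [Set.mem_ofPred_eq, Set.mem_univ_pi, Set.mem_Iic]
  rw [hset]
  constructor
  · intro h j
    by_contra! hj
    let S : Set (ι → ℝ) :=
      Set.univ.pi fun i => if i = j then Set.Iic b else Set.Icc (b - 1) b
    have hS : S ⊆ Set.univ.pi fun _ => Set.Iic b := by
      refine Set.pi_mono fun i _ => ?_
      split_ifs
      · exact subset_rfl
      · exact Set.Icc_subset_Iic_self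
    have hvol : volume S = ⊤ := by
      simp only [S, volume_pi_pi]
      rw [← Finset.mul_prod_erase _ _ (Finset.mem_univ j)]
      have h1 : ∏ i ∈ Finset.univ.erase j,
          volume (if i = j then Set.Iic b else Set.Icc (b - 1) b) = 1 := by
        refine Finset.prod_eq_one fun i hi => ?_
        simp [Finset.ne_of_mem_erase hi]
      simp [h1]
    have hlt := (h.mono_set hS).measure_norm_ge_lt_top
      (Real.exp_pos (∑ i, (c i * b - |c i|)))
    refine hlt.not_ge ?_
    rw [← hvol, ← Measure.restrict_apply_self]
    refine measure_mono_ae ?_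
    have hSm : MeasurableSet S := by
      refine MeasurableSet.univ_pi fun i => ?_
      split_ifs
      · exact measurableSet_Iic
      · exact measurableSet_Icc
    filter_upwards [ae_restrict_mem hSm] with y hy _
    change Real.exp _ ≤ ‖Real.exp _‖
    rw [Real.norm_eq_abs, Real.abs_exp, Real.exp_le_exp]
    refine Finset.sum_le_sum fun i _ => ?_
    have hyi := hy i (Set.mem_univ i)
    rcases eq_or_ne i j with rfl | hij
    · simp only [if_true, Set.mem_Iic] at hyi
      nlinarith [abs_nonneg (c i)]
    · simp only [hij, if_false, Set.mem_Icc] at hyi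
      cases abs_cases (c i) <;> nlinarith
  · intro hc
    simp_rw [IntegrableOn, volume_pi, Measure.restrict_pi_pi, Real.exp_sum]
    exact Integrable.fintype_prod_dep fun i => integrableOn_exp_mul_Iic (hc i) b

/-- The Siegel-set integral `∫_{A_t} a₁^{-p} ρ(a) da` after the coordinate
changes `b_i = a_i / a_{i+1}`, `b_i = exp y_i`: the function
`y ↦ exp (∑_{i=1}^{d-1} (i(d-i) - p(d-i)/d) y_i)` is integrable over
`{y : y_i ≤ log t for all i}` if and only if `p < d`.
(Here the coordinate `y i` for `i : Fin (d-1)` corresponds to `y_{i+1}`.) -/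
theorem siegel_integral_convergence
    (d : ℕ) (hd : 2 ≤ d) (t : ℝ) (ht : 0 < t) (p : ℝ) :
    IntegrableOn
      (fun y : Fin (d - 1) → ℝ =>
        Real.exp (∑ i : Fin (d - 1),
          ((((i : ℕ) : ℝ) + 1) * ((d : ℝ) - (((i : ℕ) : ℝ) + 1)) -
              p * ((d : ℝ) - (((i : ℕ) : ℝ) + 1)) / (d : ℝ)) * y i))
      {y : Fin (d - 1) → ℝ | ∀ i, y i ≤ Real.log t} volume
    ↔ p < d := by
  have hd0 : (0 : ℝ) < d := by positivity
  have hd2 : (2 : ℝ) ≤ d := by exact_mod_cast hd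
  refine (integrableOn_exp_sum_mul_orthant_iff _ _).trans ⟨fun h => ?_, fun hp i => ?_⟩
  · have h0 := h ⟨0, by omega⟩
    have key : (((0 : ℕ) : ℝ) + 1) * ((d : ℝ) - (((0 : ℕ) : ℝ) + 1)) -
        p * ((d : ℝ) - (((0 : ℕ) : ℝ) + 1)) / (d : ℝ) = (d - 1) / d * (d - p) := by
      push_cast
      field_simp
      ring
    rw [key] at h0
    have := pos_of_mul_pos_right h0 (div_nonneg (by linarith) hd0.le)
    linarith
  · have hi : ((i : ℕ) : ℝ) + 1 < d := by
      have := i.isLt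
      exact_mod_cast (by omega : (i : ℕ) + 1 < d)
    have hpd : p / d < 1 := (div_lt_one hd0).2 hp
    have hi0 : (0 : ℝ) ≤ ((i : ℕ) : ℝ) := by positivity
    have := mul_pos (sub_pos.2 hi) (by linarith : 0 < ((i : ℕ) : ℝ) + 1 - p / d)
    refine this.trans_eq ?_
    ring
end

section
/- Let d ≥ 2 be an integer and t, u > 0. There exists a constant c > 0, depending only on d, t and u, with the following property: for every g ∈ SL_d(ℝ) of the form g = k·a·n, where k is an orthogonal d × d matrix, a = diag(a₁,…,a_d) with all a_i > 0 and a_i ≤ t·a_{i+1} for i = 1,…,d−1, and n is an upper triangular matrix with all diagonal entries 1 and |n_{ij}| ≤ u for all 1 ≤ i < j ≤ d, and for every nonzero integer vector v ∈ ℤ^d ∖ {0}, one has ‖g v‖ ≥ c·a₁, where ‖·‖ is the Euclidean norm on ℝ^d. -/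
open Matrix

/-- A real matrix with orthonormal columns preserves the Euclidean norm. -/
theorem norm_toLp_mulVec_of_transpose_mul_self {m n : Type*} [Fintype m] [Fintype n]
    [DecidableEq n] {k : Matrix m n ℝ} (hk : kᵀ * k = 1) (w : n → ℝ) :
    ‖WithLp.toLp 2 (k *ᵥ w)‖ = ‖WithLp.toLp 2 w‖ := by
  have h : (k *ᵥ w) ⬝ᵥ (k *ᵥ w) = w ⬝ᵥ w := by
    rw [Matrix.dotProduct_mulVec, ← Matrix.mulVec_transpose, Matrix.mulVec_mulVec, hk,
      Matrix.one_mulVec]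
  simp only [dotProduct, ← sq] at h
  simp [EuclideanSpace.norm_eq, h]

/-- An upper unitriangular matrix preserves the last nonzero coordinate of a vector. -/
theorem mulVec_apply_eq_of_upper_unitriangular {ι R : Type*} [Fintype ι] [LinearOrder ι]
    [NonAssocSemiring R] {n : Matrix ι ι R} (hdiag : ∀ i, n i i = 1)
    (hlow : ∀ i j, j < i → n i j = 0) {w : ι → R} {l : ι} (hw : ∀ j, l < j → w j = 0) :
    (n *ᵥ w) l = w l := by
  rw [Matrix.mulVec, dotProduct, Finset.sum_eq_single l]
  · rw [hdiag, one_mul]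
  · intro j _ hj
    rcases lt_or_gt_of_ne hj with h | h
    · rw [hlow l j h, zero_mul]
    · rw [hw j h, mul_zero]
  · simp

/-- Iterating `a i ≤ t * a (i + 1)` bounds the first term by a power of `t` times any later one. -/
theorem apply_zero_le_pow_mul {d : ℕ} {t : ℝ} (ht : 0 ≤ t) {a : Fin d → ℝ}
    (ha : ∀ (i : ℕ) (hi : i + 1 < d), a ⟨i, Nat.lt_of_succ_lt hi⟩ ≤ t * a ⟨i + 1, hi⟩)
    (i : ℕ) (hi : i < d) : a ⟨0, by omega⟩ ≤ t ^ i * a ⟨i, hi⟩ := by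
  induction i with
  | zero => simp
  | succ i ih =>
    calc a ⟨0, by omega⟩ ≤ t ^ i * a ⟨i, Nat.lt_of_succ_lt hi⟩ := ih _
      _ ≤ t ^ i * (t * a ⟨i + 1, hi⟩) := by gcongr; exact ha i hi
      _ = t ^ (i + 1) * a ⟨i + 1, hi⟩ := by ring

/-- On a Siegel set `K A_t N_u` of `SL_d(ℝ)`, the first successive minimum of
the lattice `g ℤ^d` is bounded below by a constant multiple of `a₁`: there is
`c > 0`, depending only on `d`, `t`, `u`, such that `‖g v‖ ≥ c * a₁` for every
nonzero integer vector `v`.  (Indices are `0, …, d-1`, so `a₁ = a 0`.) -/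
theorem siegel_set_first_minimum_lower_bound
    (d : ℕ) (hd : 2 ≤ d) (t u : ℝ) (ht : 0 < t) (hu : 0 < u) :
    ∃ c : ℝ, 0 < c ∧
      ∀ (g k n : Matrix (Fin d) (Fin d) ℝ) (a : Fin d → ℝ),
        g.det = 1 →
        g = k * Matrix.diagonal a * n →
        kᵀ * k = 1 →
        (∀ i, 0 < a i) →
        (∀ (i : ℕ) (hi : i + 1 < d),
          a ⟨i, Nat.lt_of_succ_lt hi⟩ ≤ t * a ⟨i + 1, hi⟩) →
        (∀ i, n i i = 1) →
        (∀ i j : Fin d, j < i → n i j = 0) →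
        (∀ i j : Fin d, i < j → |n i j| ≤ u) →
        ∀ v : Fin d → ℤ, v ≠ 0 →
          c * a ⟨0, by omega⟩ ≤
            ‖(WithLp.equiv 2 (Fin d → ℝ)).symm
                (g.mulVec fun i => (v i : ℝ))‖ := by
  have hM : 0 < max 1 t ^ d := by positivity
  refine ⟨(max 1 t ^ d)⁻¹, inv_pos.mpr hM, ?_⟩
  rintro g k n a - rfl hk ha hat hdiag hlow - v hv
  obtain ⟨l, hl, hmax⟩ : ∃ l, v l ≠ 0 ∧ ∀ j, l < j → v j = 0 := by
    obtain ⟨i, hi⟩ := Function.ne_iff.mp hv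
    obtain ⟨l, hl⟩ := (Set.toFinite {i | v i ≠ 0}).exists_maximal ⟨i, hi⟩
    exact ⟨l, hl.prop, fun j hj => by_contra fun h => hl.not_prop_of_gt hj h⟩
  set w : Fin d → ℝ := fun i => (v i : ℝ)
  have hnw : (n *ᵥ w) l = w l :=
    mulVec_apply_eq_of_upper_unitriangular hdiag hlow fun j hj => by simp [w, hmax j hj]
  have hwl : 1 ≤ |w l| := by
    simp only [w]
    exact_mod_cast Int.one_le_abs hl
  have hal : a ⟨0, by omega⟩ ≤ max 1 t ^ d * a l :=
    calc a ⟨0, by omega⟩ ≤ t ^ (l : ℕ) * a l := apply_zero_le_pow_mul ht.le hat l l.isLt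
      _ ≤ max 1 t ^ (l : ℕ) * a l := by
        have := (ha l).le
        gcongr
        exact le_max_right _ _
      _ ≤ max 1 t ^ d * a l := by
        have := (ha l).le
        gcongr
        · exact le_max_left _ _
        · exact l.isLt.le
  calc (max 1 t ^ d)⁻¹ * a ⟨0, by omega⟩ ≤ a l := by rwa [inv_mul_le_iff₀ hM]
    _ ≤ a l * |w l| := le_mul_of_one_le_right (ha l).le hwl
    _ = ‖(WithLp.toLp 2 (Matrix.diagonal a *ᵥ n *ᵥ w)) l‖ := by
      simp [Matrix.mulVec_diagonal, hnw, abs_of_pos (ha l)]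
    _ ≤ ‖WithLp.toLp 2 (Matrix.diagonal a *ᵥ n *ᵥ w)‖ := PiLp.norm_apply_le _ l
    _ = ‖WithLp.toLp 2 ((k * Matrix.diagonal a * n) *ᵥ w)‖ := by
      rw [← norm_toLp_mulVec_of_transpose_mul_self hk]
      simp only [Matrix.mulVec_mulVec, Matrix.mul_assoc]
end
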